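/- Let F(s) = ξ(2)·ξ(s+2)ξ(2s)/(s−3) − ξ(2)·ξ(s−2)ξ(2s−1)/(s+2) + ξ(s−2)ξ(2s−1)/(2s−2) − ξ(s+2)ξ(2s)/(2s) − ξ(s−1)ξ(2s−1)/(s(s−3)) − ξ(s+1)ξ(2s)/((s−1)(s+2)) − ξ(s)ξ(2s)/((2s−2)(s+1)) − ξ(s)ξ(2s−1)/((2s)(s−2)). Then for every complex s with s ∉ {−2, −1, 0, 1/2, 1, 2, 3}, one has F(1−s) = F(s). -/

import Mathlib

open Complex

local notation "ξ" => completedRiemannZeta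

/-- Weng's zeta function `ξ_ℚ^{G₂/P_short}(s)`. -/
noncomputable def wengG2Pshort (s : ℂ) : ℂ :=
  ξ 2 * ξ (s + 2) * ξ (2*s) / (s - 3)
    - ξ 2 * ξ (s - 2) * ξ (2*s - 1) / (s + 2)
    + ξ (s - 2) * ξ (2*s - 1) / (2*s - 2)
    - ξ (s + 2) * ξ (2*s) / (2*s)
    - ξ (s - 1) * ξ (2*s - 1) / (s * (s - 3))
    - ξ (s + 1) * ξ (2*s) / ((s - 1) * (s + 2))
    - ξ s * ξ (2*s) / ((2*s - 2) * (s + 1))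
    - ξ s * ξ (2*s - 1) / ((2*s) * (s - 2))

/-- Functional equation for Weng's zeta of `(G₂, P_short)` over `ℚ`. -/
theorem wengG2Pshort_functional_equation (s : ℂ)
    (hs : s ∉ ({-2, -1, 0, 1/2, 1, 2, 3} : Set ℂ)) :
    wengG2Pshort (1 - s) = wengG2Pshort s := by
  have reflect {a b : ℂ} (h : a = 1 - b) : ξ a = ξ b := by
    rw [h, completedRiemannZeta_one_sub]
  unfold wengG2Pshort
  rw [reflect (show 1 - s + 2 = 1 - (s - 2) by ring),
    reflect (show 2 * (1 - s) = 1 - (2 * s - 1) by ring),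
    reflect (show 1 - s - 2 = 1 - (s + 2) by ring),
    reflect (show 2 * (1 - s) - 1 = 1 - 2 * s by ring),
    reflect (show 1 - s - 1 = 1 - (s + 1) by ring),
    reflect (show 1 - s + 1 = 1 - (s - 1) by ring),
    completedRiemannZeta_one_sub s,
    show (1 - s) * (1 - s - 3) = (s - 1) * (s + 2) by ring,
    show (1 - s - 1) * (1 - s + 2) = s * (s - 3) by ring,
    show (2 * (1 - s) - 2) * (1 - s + 1) = 2 * s * (s - 2) by ring,
    show 2 * (1 - s) * (1 - s - 2) = (2 * s - 2) * (s + 1) by ring,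
    show 1 - s - 3 = -(s + 2) by ring, show 1 - s + 2 = -(s - 3) by ring,
    show 2 * (1 - s) - 2 = -(2 * s) by ring, show 2 * (1 - s) = -(2 * s - 2) by ring]
  simp only [div_neg]
  abel
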